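/- Let S be a real ν × ν symmetric positive definite matrix with ν ≥ 2. Then its smallest eigenvalue satisfies λ_min(S) ≥ ((ν − 1)/trace(S))^{ν−1} · det(S). -/

import Mathlib

open Matrix

lemma amgm_pow_aux {ι : Type*} (s : Finset ι) (z : ι → ℝ) (hz : ∀ i ∈ s, 0 ≤ z i)
    (hs : 0 < s.card) : ∏ i ∈ s, z i ≤ ((∑ i ∈ s, z i) / s.card) ^ s.card := by
  have h := Real.geom_mean_le_arith_mean s (fun _ => 1) z (by simp) (by simpa using hs) hz
  simp only [Real.rpow_one, one_mul, Finset.sum_const, nsmul_eq_mul, mul_one] at h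
  have hp : 0 ≤ ∏ i ∈ s, z i := Finset.prod_nonneg hz
  calc ∏ i ∈ s, z i = ((∏ i ∈ s, z i) ^ ((s.card : ℝ)⁻¹)) ^ s.card :=
        (Real.rpow_inv_natCast_pow hp hs.ne').symm
    _ ≤ _ := pow_le_pow_left₀ (Real.rpow_nonneg hp _) h _

/-- For a real symmetric positive definite `ν × ν` matrix `S` with `ν ≥ 2`, the
smallest eigenvalue satisfies `λ_min(S) ≥ ((ν-1)/trace(S))^(ν-1) · det(S)`. -/
theorem lambda_min_ge_trace_det_bound {ν : ℕ} (hν : 2 ≤ ν)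
    (S : Matrix (Fin ν) (Fin ν) ℝ) (hS : S.PosDef) :
    ((ν - 1 : ℝ) / S.trace) ^ (ν - 1) * S.det ≤ ⨅ i, hS.1.eigenvalues i := by
  haveI : Nonempty (Fin ν) := ⟨⟨0, by omega⟩⟩
  refine le_ciInf fun i => ?_
  have hpos : ∀ j, 0 < hS.1.eigenvalues j := hS.eigenvalues_pos
  have htr : S.trace = ∑ j, hS.1.eigenvalues j := by
    simpa using hS.1.trace_eq_sum_eigenvalues
  have hdet : S.det = ∏ j, hS.1.eigenvalues j := by
    simpa using hS.1.det_eq_prod_eigenvalues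
  generalize hS.1.eigenvalues = l at *
  rw [htr, hdet, ← Finset.mul_prod_erase _ _ (Finset.mem_univ i)]
  have hT : 0 < ∑ j, l j := Finset.sum_pos (fun j _ => hpos j) Finset.univ_nonempty
  have hcard : (Finset.univ.erase i).card = ν - 1 := by simp
  have hn : (0 : ℝ) < ν - 1 := by
    have : (2 : ℝ) ≤ ν := by exact_mod_cast hν
    linarith
  have hcast : ((ν - 1 : ℕ) : ℝ) = ν - 1 := by
    rw [Nat.cast_sub (by omega)]; simp
  have h1 := amgm_pow_aux (Finset.univ.erase i) l (fun j _ => (hpos j).le) (by omega)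
  rw [hcard, hcast] at h1
  have h2 : ∑ j ∈ Finset.univ.erase i, l j ≤ ∑ j, l j :=
    Finset.sum_le_sum_of_subset_of_nonneg (Finset.erase_subset _ _) (fun j _ _ => (hpos j).le)
  have h0 : 0 ≤ ∑ j ∈ Finset.univ.erase i, l j := Finset.sum_nonneg fun j _ => (hpos j).le
  have h3 : ∏ j ∈ Finset.univ.erase i, l j ≤ ((∑ j, l j) / ((ν : ℝ) - 1)) ^ (ν - 1) :=
    h1.trans (pow_le_pow_left₀ (by positivity) (by gcongr) _)
  calc (((ν : ℝ) - 1) / ∑ j, l j) ^ (ν - 1) * (l i * ∏ j ∈ Finset.univ.erase i, l j)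
      ≤ (((ν : ℝ) - 1) / ∑ j, l j) ^ (ν - 1) *
          (l i * ((∑ j, l j) / ((ν : ℝ) - 1)) ^ (ν - 1)) := by
        have := (hpos i).le
        gcongr
    _ = l i * ((((ν : ℝ) - 1) / ∑ j, l j) * ((∑ j, l j) / ((ν : ℝ) - 1))) ^ (ν - 1) := by
        rw [mul_pow]; ring
    _ = l i := by
        rw [div_mul_div_cancel₀ hT.ne', div_self hn.ne']; simp
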